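/- arXiv:2512.05219 — 7 statements merged into one kernel-verified Lean document; each statement's English description precedes it below -/
import Mathlib

section
/- Let K be a field of characteristic zero and R a commutative integral domain which is a K-algebra. Let D be a K-linear derivation of the polynomial ring R[X] such that D(C r) = 0 for every r ∈ R (where C : R → R[X] is the constant embedding) and D is locally nilpotent, i.e. for every f ∈ R[X] there exists n ≥ 1 with D iterated n times applied to f equal to 0. Then there exists h ∈ R such that D(f) = C h * f' for every f ∈ R[X], where f' denotes the formal derivative of f with respect to X; in particular D(X) = C h is a constant polynomial. -/
open Polynomial in
/-- A derivation of `R[X]` killing the constants is determined by its value at `X`. -/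
theorem derivation_eq_mul_derivative {K R : Type*} [CommSemiring K] [CommRing R] [Algebra K R]
    (D : Derivation K R[X] R[X]) (hC : ∀ r : R, D (C r) = 0) (f : R[X]) :
    D f = D X * derivative f := by
  induction f using Polynomial.induction_on' with
  | add p q hp hq => rw [map_add, hp, hq, derivative_add, mul_add]
  | monomial n a =>
    rw [← C_mul_X_pow_eq_monomial, D.leibniz, D.leibniz_pow, hC, derivative_C_mul_X_pow]
    simp only [smul_eq_mul, nsmul_eq_mul, mul_zero, add_zero, map_mul, map_natCast]
    ring

open Polynomial in
/-- In characteristic zero, `f ↦ p * f'` with `p` nonconstant preserves nonconstancy. -/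
theorem natDegree_mul_derivative_pos {R : Type*} [CommRing R] [IsDomain R] [CharZero R]
    {p f : R[X]} (hp : 0 < p.natDegree) (hf : 0 < f.natDegree) :
    0 < (p * derivative f).natDegree := by
  have hp0 : p ≠ 0 := ne_zero_of_natDegree_gt hp
  have hf0 : derivative f ≠ 0 := fun h => hf.ne' (derivative_eq_zero.1 h)
  rw [natDegree_mul hp0 hf0]
  exact Nat.add_pos_left hp _

/-- If `D` is a locally nilpotent `K`-derivation of `R[X]` killing all constants,
then `D f = C h * f'` for some fixed `h ∈ R`. -/
theorem stmt_0 (K : Type*) (R : Type*) [Field K] [CharZero K]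
    [CommRing R] [IsDomain R] [Algebra K R]
    (D : Derivation K (Polynomial R) (Polynomial R))
    (hC : ∀ r : R, D (Polynomial.C r) = 0)
    (hln : ∀ f : Polynomial R, ∃ n : ℕ, 1 ≤ n ∧ (fun g => D g)^[n] f = 0) :
    ∃ h : R, ∀ f : Polynomial R,
      D f = Polynomial.C h * Polynomial.derivative f := by
  have : CharZero R := charZero_of_injective_algebraMap (algebraMap K R).injective
  have hD := derivation_eq_mul_derivative D hC
  have hdeg : (D Polynomial.X).natDegree = 0 := by
    by_contra hne
    have hpos : ∀ n : ℕ, 0 < ((fun g => D g)^[n] Polynomial.X).natDegree := by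
      intro n
      induction n with
      | zero => simp
      | succ n ih =>
        rw [Function.iterate_succ_apply', hD]
        exact natDegree_mul_derivative_pos (Nat.pos_of_ne_zero hne) ih
    obtain ⟨n, -, hn⟩ := hln Polynomial.X
    simpa [hn] using hpos n
  refine ⟨(D Polynomial.X).coeff 0, fun f => ?_⟩
  rw [← Polynomial.eq_C_of_natDegree_eq_zero hdeg]
  exact hD f
end

section
/- Let K be an algebraically closed field of characteristic zero and V a finite-dimensional K-vector space. Let Q be a quadratic form on V of rank at least 3 and let v ∈ V satisfy Q(v) = 0 with polar Q(v, ·) not identically zero (a smooth point of the quadric {Q = 0}). Then there exists w ∈ V with Q(w) = 0, polar Q(w, ·) not identically zero, and polar Q(w, v) ≠ 0. (Geometrically: for every smooth point x of a quadric X ⊆ ℙⁿ of rank at least three there is a smooth point y of X such that x does not lie on the projective tangent hyperplane of X at y, so the open sets X ∖ 𝕋_y X cover the smooth locus of X.) -/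
/-- For every smooth point `v` of a quadric of rank at least three there is a smooth
point `w` of the quadric whose tangent hyperplane does not contain `v`. -/
theorem stmt_2 (K : Type*) [Field K] [IsAlgClosed K] [CharZero K]
    (V : Type*) [AddCommGroup V] [Module K V] [FiniteDimensional K V]
    (Q : QuadraticForm K V)
    (hrank : Module.finrank K (LinearMap.ker (QuadraticMap.polarBilin Q) : Submodule K V)
        + 3 ≤ Module.finrank K V)
    (v : V) (hQv : Q v = 0)
    (hsm : QuadraticMap.polarBilin Q v ≠ 0) :
    ∃ w : V, Q w = 0 ∧ QuadraticMap.polarBilin Q w ≠ 0 ∧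
      QuadraticMap.polar Q w v ≠ 0 := by
  obtain ⟨u, hu⟩ : ∃ u, QuadraticMap.polar Q u v ≠ 0 := by
    by_contra! h
    refine hsm (LinearMap.ext fun u => ?_)
    simpa [QuadraticMap.polar_comm Q v u] using h u
  have hpolar (c : K) : QuadraticMap.polar Q (u + c • v) v = QuadraticMap.polar Q u v := by
    simp [QuadraticMap.polar_add_left, QuadraticMap.polar_smul_left, QuadraticMap.polar_self, hQv]
  set c : K := -(Q u / QuadraticMap.polar Q u v) with hc
  have hw : QuadraticMap.polar Q (u + c • v) v ≠ 0 := by rwa [hpolar]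
  refine ⟨u + c • v, ?_, fun h => hw ?_, hw⟩
  · rw [QuadraticMap.map_add Q, QuadraticMap.map_smul, hQv, QuadraticMap.polar_smul_right, hc]
    simp only [smul_eq_mul]
    field_simp
    ring
  · simpa using LinearMap.congr_fun h v
end

section
/- Let K be an algebraically closed field of characteristic zero and m ≥ 2. On V = K^{2m} with coordinates (x₁, y₁, …, x_m, y_m), let f(v) = x₁y₁ + ⋯ + x_m y_m and let Y = {v ∈ V : f(v) ≠ 0}. Suppose S ⊆ Y is a nonempty subset such that: (i) S is closed under multiplication by nonzero scalars of K; and (ii) for every index i ∈ {1, …, m} and all v, w ∈ V with v ∈ S, x_i(v) = 1, x_i(w) = 1, and f(w) = f(v), one has w ∈ S. Then S = Y. (This is the transversality of the covering of ℙ^{2m−1} ∖ X by the m cylinders U_i = 𝔻(x_i · f), where X is the smooth quadric {f = 0}: the 𝔸¹-fibers of U_i are exactly the sets of points with x_i = 1 and fixed nonzero value of f.) -/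
/-- Transversality of the covering of the complement of the smooth quadric
`{Σ xᵢyᵢ = 0}` in odd-dimensional projective space by the `m` cylinders
`𝔻(xᵢ·f)`: a nonempty subset of `Y = {f ≠ 0}` which is closed under nonzero
scalars and under moving along the cylinder fibers (the level sets of `f` in
the charts `xᵢ = 1`) is all of `Y`. -/
theorem stmt_5 (K : Type*) [Field K] [IsAlgClosed K] [CharZero K]
    (m : ℕ) (hm : 2 ≤ m)
    (f : (Fin m → K × K) → K)
    (hf : ∀ v, f v = ∑ i, (v i).1 * (v i).2)
    (Y : Set (Fin m → K × K)) (hY : Y = {v | f v ≠ 0})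
    (S : Set (Fin m → K × K)) (hSY : S ⊆ Y) (hSne : S.Nonempty)
    (hscal : ∀ (c : K), c ≠ 0 → ∀ v ∈ S, c • v ∈ S)
    (hfib : ∀ (i : Fin m) (v w : Fin m → K × K), v ∈ S →
      (v i).1 = 1 → (w i).1 = 1 → f w = f v → w ∈ S) :
    S = Y := by
  have hsmul : ∀ (c : K) v, f (c • v) = c ^ 2 * f v := fun c v ↦ by
    simp only [hf, Finset.mul_sum, Pi.smul_apply, Prod.smul_fst, Prod.smul_snd, smul_eq_mul]
    exact Finset.sum_congr rfl fun i _ ↦ by ring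
  have hcoord : ∀ v, f v ≠ 0 → ∃ i, (v i).1 ≠ 0 := fun v hv ↦ by
    by_contra! h
    exact hv (by simp [hf, h])
  -- the fiber condition in homogeneous form: `f / xᵢ²` is constant along the fibers
  have hfib' : ∀ (i : Fin m) v w, v ∈ S → (v i).1 ≠ 0 → (w i).1 ≠ 0 →
      f w * (v i).1 ^ 2 = f v * (w i).1 ^ 2 → w ∈ S := fun i v w hv hvi hwi h ↦ by
    have key := hfib i ((v i).1⁻¹ • v) ((w i).1⁻¹ • w) (hscal _ (inv_ne_zero hvi) v hv)
      (by simp [hvi]) (by simp [hwi]) (by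
        rw [hsmul, hsmul]
        field_simp
        linear_combination h)
    simpa [smul_smul, hwi] using hscal _ hwi _ key
  have hmove : ∀ i j : Fin m, i ≠ j → ∀ v w, v ∈ S → (v i).1 ≠ 0 → f w ≠ 0 →
      (w j).1 ≠ 0 → w ∈ S := fun i j hij v w hv hvi hw hwj ↦ by
    have hfv : f v ≠ 0 := by simpa [hY] using hSY hv
    obtain ⟨t, ht⟩ := IsAlgClosed.exists_pow_nat_eq
      (f v / (v i).1 ^ 2 * (w j).1 ^ 2 / f w) (n := 2) two_pos
    have ht0 : t ≠ 0 := by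
      rintro rfl
      have : f v / (v i).1 ^ 2 * (w j).1 ^ 2 / f w ≠ 0 := by positivity
      simp_all
    let u : Fin m → K × K := Function.update (Pi.single j (t, 0)) i (1, f v / (v i).1 ^ 2)
    have hui : u i = (1, f v / (v i).1 ^ 2) := by simp [u]
    have huj : u j = (t, 0) := by simp [u, hij.symm]
    have hfu : f u = f v / (v i).1 ^ 2 := by
      rw [hf, Finset.sum_eq_single i _ (by simp), hui, one_mul]
      intro k _ hk
      obtain rfl | hkj := eq_or_ne k j
      · simp [huj]
      · simp [u, hk, hkj]
    have hu : u ∈ S := hfib' i v u hv hvi (by simp [hui]) (by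
      rw [hfu, hui]
      field_simp)
    refine hfib' j u w hu (by simpa [huj] using ht0) hwj ?_
    rw [huj, ht, hfu]
    field_simp
  refine hSY.antisymm fun w hw ↦ ?_
  have hfw : f w ≠ 0 := by simpa [hY] using hw
  obtain ⟨v, hv⟩ := hSne
  obtain ⟨i, hi⟩ := hcoord v (by simpa [hY] using hSY hv)
  obtain ⟨j, hj⟩ := hcoord w hfw
  obtain rfl | hij := eq_or_ne i j
  · have : Nontrivial (Fin m) := Fin.nontrivial_iff_two_le.mpr hm
    obtain ⟨k, hk⟩ := exists_ne i
    have hfu : f (Pi.single k (1, 1)) = 1 := by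
      rw [hf, Finset.sum_eq_single k _ (by simp)]
      · simp
      · intro l _ hl
        simp [hl]
    have hu : Pi.single k (1, 1) ∈ S :=
      hmove i k hk.symm v _ hv hi (by simp [hfu]) (by simp)
    exact hmove k i hk _ w hu (by simp) hfw hj
  · exact hmove i j hij v w hv hi hfw hj
end

section
/- Let K be an algebraically closed field of characteristic zero and m ≥ 1. On V = K^{2m+1} with coordinates (x₁, y₁, …, x_m, y_m, z), let f(v) = x₁y₁ + ⋯ + x_m y_m + z², let r = (0, …, 0, 1), and let Y′ = {v ∈ V : f(v) ≠ 0 and v is not a scalar multiple of r}. Suppose S ⊆ Y′ is a nonempty subset such that: (i) S is closed under multiplication by nonzero scalars of K; (ii) for every i ∈ {1, …, m} and all v, w ∈ V with v ∈ S, x_i(v) = 1, x_i(w) = 1, and f(w) = f(v), one has w ∈ S; and (iii) the same condition with x_i replaced by y_i. Then S = Y′. (This is the transversality, away from the single point r, of the covering of ℙ^{2m} ∖ X by the 2m cylinders U_i = 𝔻(x_i · f) and V_i = 𝔻(y_i · f), where X is the smooth quadric {f = 0}.) -/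
/-- Let `f` be homogeneous of degree two, `p` and `q` homogeneous of degree one, and let `S` be a
cone saturated for the level sets of `f` on `{p = 1}` and on `{q = 1}`. If `(p, q, f)` takes every
value `(1, t, c)`, then a single point of `S` with `p ≠ 0` and `f ≠ 0` forces `S` to contain
all of `{q ≠ 0, f ≠ 0}`. -/
theorem mem_of_saturated_of_ne_zero {K V : Type*} [Field K] [IsAlgClosed K]
    [AddCommGroup V] [Module K V] {f p q : V → K} {S : Set V}
    (hf : ∀ (c : K) v, f (c • v) = c ^ 2 * f v)
    (hp : ∀ (c : K) v, p (c • v) = c * p v)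
    (hq : ∀ (c : K) v, q (c • v) = c * q v)
    (hex : ∀ c t : K, ∃ w, p w = 1 ∧ q w = t ∧ f w = c)
    (hscal : ∀ c : K, c ≠ 0 → ∀ v ∈ S, c • v ∈ S)
    (hSp : ∀ v w, v ∈ S → p v = 1 → p w = 1 → f w = f v → w ∈ S)
    (hSq : ∀ v w, v ∈ S → q v = 1 → q w = 1 → f w = f v → w ∈ S)
    {v u : V} (hv : v ∈ S) (hpv : p v ≠ 0) (hfv : f v ≠ 0) (hqu : q u ≠ 0) (hfu : f u ≠ 0) :
    u ∈ S := by
  have hc : f ((p v)⁻¹ • v) ≠ 0 := by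
    rw [hf]; exact mul_ne_zero (pow_ne_zero _ (inv_ne_zero hpv)) hfv
  have hd : f ((q u)⁻¹ • u) ≠ 0 := by
    rw [hf]; exact mul_ne_zero (pow_ne_zero _ (inv_ne_zero hqu)) hfu
  obtain ⟨t, ht⟩ := IsAlgClosed.exists_pow_nat_eq
    (f ((p v)⁻¹ • v) / f ((q u)⁻¹ • u)) (n := 2) two_pos
  have ht0 : t ≠ 0 := by
    rintro rfl
    exact div_ne_zero hc hd (by rw [← ht]; simp)
  obtain ⟨w, hpw, hqw, hfw⟩ := hex (f ((p v)⁻¹ • v)) t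
  have hw : w ∈ S :=
    hSp _ w (hscal _ (inv_ne_zero hpv) v hv) (by rw [hp, inv_mul_cancel₀ hpv]) hpw hfw
  have hu : (q u)⁻¹ • u ∈ S := by
    refine hSq _ _ (hscal _ (inv_ne_zero ht0) w hw) (by rw [hq, hqw, inv_mul_cancel₀ ht0])
      (by rw [hq, inv_mul_cancel₀ hqu]) ?_
    rw [hf t⁻¹, hfw, inv_pow, ht, inv_div, div_mul_cancel₀ _ hc]
  simpa [smul_smul, mul_inv_cancel₀ hqu] using hscal _ hqu _ hu

/-- Transversality, away from the single point `r = (0,…,0,1)`, of the covering of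
the complement of the smooth quadric `{Σ xᵢyᵢ + z² = 0}` in even-dimensional
projective space by the `2m` cylinders `𝔻(xᵢ·f)` and `𝔻(yᵢ·f)`. -/
theorem stmt_6 (K : Type*) [Field K] [IsAlgClosed K] [CharZero K]
    (m : ℕ) (hm : 1 ≤ m)
    (f : (Fin m → K × K) × K → K)
    (hf : ∀ v, f v = (∑ i, (v.1 i).1 * (v.1 i).2) + v.2 ^ 2)
    (r : (Fin m → K × K) × K) (hr : r = (0, 1))
    (Y' : Set ((Fin m → K × K) × K))
    (hY' : Y' = {v | f v ≠ 0 ∧ ¬∃ c : K, v = c • r})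
    (S : Set ((Fin m → K × K) × K)) (hSY : S ⊆ Y') (hSne : S.Nonempty)
    (hscal : ∀ (c : K), c ≠ 0 → ∀ v ∈ S, c • v ∈ S)
    (hfibx : ∀ (i : Fin m) (v w : (Fin m → K × K) × K), v ∈ S →
      (v.1 i).1 = 1 → (w.1 i).1 = 1 → f w = f v → w ∈ S)
    (hfiby : ∀ (i : Fin m) (v w : (Fin m → K × K) × K), v ∈ S →
      (v.1 i).2 = 1 → (w.1 i).2 = 1 → f w = f v → w ∈ S) :
    S = Y' := by
  subst hr hY'
  have hfs : ∀ (c : K) v, f (c • v) = c ^ 2 * f v := by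
    intro c v
    simp only [hf, Prod.smul_fst, Prod.smul_snd, Pi.smul_apply, smul_eq_mul, mul_add,
      Finset.mul_sum]
    congr 1
    · exact Finset.sum_congr rfl fun i _ => by ring
    · ring
  have hsingle : ∀ (i : Fin m) (a b s : K), f (Pi.single i (a, b), s) = a * b + s ^ 2 := by
    intro i a b s
    rw [hf, Finset.sum_eq_single i]
    · simp
    · intro j _ hj
      simp [Pi.single_eq_of_ne hj]
    · simp
  have hxy : ∀ (i : Fin m) v u, v ∈ S → (v.1 i).1 ≠ 0 → (u.1 i).2 ≠ 0 → f u ≠ 0 → u ∈ S := by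
    intro i v u hv hvi hui hfu
    refine mem_of_saturated_of_ne_zero (f := f) (p := fun v => (v.1 i).1)
      (q := fun v => (v.1 i).2) hfs (fun _ _ => rfl) (fun _ _ => rfl) (fun c t => ?_) hscal
      (hfibx i) (hfiby i) hv hvi (hSY hv).1 hui hfu
    obtain ⟨s, hs⟩ := IsAlgClosed.exists_pow_nat_eq (c - t) (n := 2) two_pos
    exact ⟨(Pi.single i (1, t), s), by simp, by simp, by rw [hsingle, hs]; ring⟩
  have hyx : ∀ (i : Fin m) v u, v ∈ S → (v.1 i).2 ≠ 0 → (u.1 i).1 ≠ 0 → f u ≠ 0 → u ∈ S := by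
    intro i v u hv hvi hui hfu
    refine mem_of_saturated_of_ne_zero (f := f) (p := fun v => (v.1 i).2)
      (q := fun v => (v.1 i).1) hfs (fun _ _ => rfl) (fun _ _ => rfl) (fun c t => ?_) hscal
      (hfiby i) (hfibx i) hv hvi (hSY hv).1 hui hfu
    obtain ⟨s, hs⟩ := IsAlgClosed.exists_pow_nat_eq (c - t) (n := 2) two_pos
    exact ⟨(Pi.single i (t, 1), s), by simp, by simp, by rw [hsingle, hs]; ring⟩
  have hcoord : ∀ v : (Fin m → K × K) × K, (¬∃ c : K, v = c • ((0, 1) : (Fin m → K × K) × K)) →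
      ∃ i, (v.1 i).1 ≠ 0 ∨ (v.1 i).2 ≠ 0 := by
    intro v hv
    by_contra! h
    refine hv ⟨v.2, Prod.ext (funext fun i => Prod.ext ?_ ?_) ?_⟩
    · simpa using (h i).1
    · simpa using (h i).2
    · simp
  have hpoint : ∀ i : Fin m, f (Pi.single i (0, 1), 1) ≠ 0 := by
    intro i
    simp [hsingle]
  have hbase : ((fun _ => (1, 0), 1) : (Fin m → K × K) × K) ∈ S := by
    have hfb : f (fun _ => (1, 0), 1) ≠ 0 := by simp [hf]
    obtain ⟨v, hv⟩ := hSne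
    obtain ⟨i, hi | hi⟩ := hcoord v (hSY hv).2
    · exact hyx i _ _ (hxy i v (Pi.single i (0, 1), 1) hv hi (by simp) (hpoint i))
        (by simp) (by simp) hfb
    · exact hyx i v _ hv hi (by simp) hfb
  refine hSY.antisymm fun u hu => ?_
  obtain ⟨i, hi | hi⟩ := hcoord u hu.2
  · exact hyx i _ u (hxy i _ (Pi.single i (0, 1), 1) hbase (by simp) (by simp) (hpoint i))
      (by simp) hi hu.1
  · exact hxy i _ u hbase (by simp) hi hu.1
end

section
/- Let K be an algebraically closed field of characteristic zero and V a finite-dimensional K-vector space with dim V ≥ 6. Let Q₁ and Q₂ be quadratic forms on V, and let p ∈ V be a nonzero vector with Q₁(p) = 0 and Q₂(p) = 0. Then there exists a vector x ∈ V, not lying in the span of p, such that Q₁ and Q₂ vanish identically on the span of {p, x}, i.e. Q₁(a·p + b·x) = 0 and Q₂(a·p + b·x) = 0 for all a, b ∈ K. (Geometrically: through every point of a complete intersection of two quadrics in ℙ^{n+2} with n ≥ 3 there passes a line contained in the intersection.) -/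
/-- Over an algebraically closed field of characteristic zero, a quadratic form has an isotropic
vector in the plane spanned by two linearly independent vectors. -/
theorem QuadraticMap.exists_smul_add_smul_eq_zero {K V : Type*} [Field K] [IsAlgClosed K]
    [CharZero K] [AddCommGroup V] [Module K V] (Q : QuadraticForm K V) {u w : V}
    (h : LinearIndependent K ![u, w]) :
    ∃ a b : K, a • u + b • w ≠ 0 ∧ Q (a • u + b • w) = 0 := by
  rw [LinearIndependent.pair_iff] at h
  by_cases hu : Q u = 0
  · refine ⟨1, 0, fun h0 => one_ne_zero (h 1 0 h0).1, by simpa using hu⟩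
  · obtain ⟨s, hs⟩ := IsAlgClosed.exists_pow_nat_eq
      (discrim (Q u) (QuadraticMap.polar Q u w) (Q w)) (n := 2) two_pos
    obtain ⟨a, ha⟩ := exists_quadratic_eq_zero hu ⟨s, by rw [← hs, pow_two]⟩
    refine ⟨a, 1, fun h0 => one_ne_zero (h a 1 h0).2, ?_⟩
    rw [QuadraticMap.map_add Q, QuadraticMap.map_smul, QuadraticMap.polar_smul_left, one_smul]
    simp only [smul_eq_mul]
    linear_combination ha

open Module in
/-- Two bilinear forms on a nonzero finite-dimensional space over an algebraically closed field
have a nontrivial linear combination with nonzero kernel. -/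
theorem LinearMap.exists_smul_apply_eq_smul_apply {K U : Type*} [Field K] [IsAlgClosed K]
    [AddCommGroup U] [Module K U] [FiniteDimensional K U] [Nontrivial U]
    (f g : U →ₗ[K] Dual K U) :
    ∃ v : U, v ≠ 0 ∧ (g v = 0 ∨ ∃ t : K, f v = t • g v) := by
  by_cases hg : LinearMap.ker g = ⊥
  · let e : U ≃ₗ[K] Dual K U := LinearEquiv.ofInjectiveOfFinrankEq g
      (LinearMap.ker_eq_bot.1 hg) Subspace.dual_finrank_eq.symm
    obtain ⟨t, ht⟩ := Module.End.exists_eigenvalue (e.symm.toLinearMap ∘ₗ f)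
    obtain ⟨v, hv⟩ := ht.exists_hasEigenvector
    refine ⟨v, hv.2, Or.inr ⟨t, ?_⟩⟩
    have h : e.symm (f v) = t • v := hv.apply_eq_smul
    rw [LinearEquiv.symm_apply_eq, map_smul] at h
    exact h
  · obtain ⟨v, hv, hv0⟩ := (Submodule.ne_bot_iff _).1 hg
    exact ⟨v, hv0, Or.inl hv⟩

open Module in
/-- If a quadratic form `Q` on a space of dimension at least three has a nonzero vector in its
radical, then `Q` and any other quadratic form have a common nontrivial zero. -/
theorem QuadraticMap.exists_common_zero_of_polar_eq_zero {K U : Type*} [Field K] [IsAlgClosed K]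
    [CharZero K] [AddCommGroup U] [Module K U] [FiniteDimensional K U] (hU : 3 ≤ finrank K U)
    (Q R : QuadraticForm K U) {v : U} (hv : v ≠ 0) (hQ : ∀ y, QuadraticMap.polar Q v y = 0) :
    ∃ x : U, x ≠ 0 ∧ Q x = 0 ∧ R x = 0 := by
  have hv0 : Q v = 0 := by
    have h := hQ v
    rw [QuadraticMap.polar_self] at h
    simpa using h
  obtain ⟨C, hC⟩ := Submodule.exists_isCompl (K ∙ v)
  have hdim := Submodule.finrank_add_eq_of_isCompl hC
  rw [finrank_span_singleton hv] at hdim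
  have : Nontrivial C := nontrivial_of_finrank_pos (R := K) (by omega)
  obtain ⟨c, hc⟩ := exists_ne (0 : C)
  obtain ⟨d, hcd⟩ := exists_linearIndependent_pair_of_one_lt_finrank
    (R := K) (M := C) (by omega) hc
  obtain ⟨a, b, hw, hQw⟩ := (Q.comp C.subtype).exists_smul_add_smul_eq_zero hcd
  set w : C := a • c + b • d
  replace hQw : Q (w : U) = 0 := hQw
  have hvw : LinearIndependent K ![v, (w : U)] := by
    rw [LinearIndependent.pair_iff' hv]
    intro t ht
    exact hw (Subtype.ext (Submodule.disjoint_def.1 hC.disjoint _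
      (Submodule.mem_span_singleton.2 ⟨t, ht⟩) w.2))
  obtain ⟨s, t, hx, hR⟩ := R.exists_smul_add_smul_eq_zero hvw
  refine ⟨_, hx, ?_, hR⟩
  rw [QuadraticMap.map_add Q, QuadraticMap.map_smul, QuadraticMap.map_smul,
    QuadraticMap.polar_smul_left, QuadraticMap.polar_smul_right, hQ, hv0, hQw]
  simp

open Module in
/-- Two quadratic forms in at least three variables over an algebraically closed field of
characteristic zero have a common nontrivial zero. -/
theorem QuadraticMap.exists_common_zero {K U : Type*} [Field K] [IsAlgClosed K]
    [CharZero K] [AddCommGroup U] [Module K U] [FiniteDimensional K U] (hU : 3 ≤ finrank K U)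
    (Q R : QuadraticForm K U) : ∃ x : U, x ≠ 0 ∧ Q x = 0 ∧ R x = 0 := by
  have : Nontrivial U := nontrivial_of_finrank_pos (R := K) (by omega)
  obtain ⟨v, hv, h | ⟨t, h⟩⟩ :=
    LinearMap.exists_smul_apply_eq_smul_apply Q.polarBilin R.polarBilin
  · obtain ⟨x, hx, hR, hQ⟩ := R.exists_common_zero_of_polar_eq_zero hU Q hv
      fun y => LinearMap.congr_fun h y
    exact ⟨x, hx, hQ, hR⟩
  · obtain ⟨x, hx, hQ, hR⟩ := (Q - t • R).exists_common_zero_of_polar_eq_zero hU R hv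
      fun y => by
        have hy : QuadraticMap.polar Q v y = t * QuadraticMap.polar R v y :=
          LinearMap.congr_fun h y
        simp only [QuadraticMap.polar, sub_apply, smul_apply,
          smul_eq_mul] at hy ⊢
        linear_combination hy
    refine ⟨x, hx, ?_, hR⟩
    simpa [hR] using hQ

/-- Through every point of a complete intersection of two quadrics in `ℙ^{n+2}`,
`n ≥ 3`, there passes a line contained in the intersection: for `dim V ≥ 6` and a
nonzero `p` with `Q₁(p) = Q₂(p) = 0` there is `x ∉ ⟨p⟩` such that both forms
vanish identically on the span of `p` and `x`. -/
theorem stmt_10 (K : Type*) [Field K] [IsAlgClosed K] [CharZero K]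
    (V : Type*) [AddCommGroup V] [Module K V] [FiniteDimensional K V]
    (hdim : 6 ≤ Module.finrank K V)
    (Q₁ Q₂ : QuadraticForm K V)
    (p : V) (hp : p ≠ 0) (hp₁ : Q₁ p = 0) (hp₂ : Q₂ p = 0) :
    ∃ x : V, x ∉ Submodule.span K ({p} : Set V) ∧
      ∀ a b : K, Q₁ (a • p + b • x) = 0 ∧ Q₂ (a • p + b • x) = 0 := by
  obtain ⟨C, hC⟩ := Submodule.exists_isCompl (Submodule.span K ({p} : Set V))
  have hCdim := Submodule.finrank_add_eq_of_isCompl hC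
  rw [finrank_span_singleton hp] at hCdim
  let f : C →ₗ[K] K × K := ((Q₁.polarBilin p).prod (Q₂.polarBilin p)) ∘ₗ C.subtype
  have hf := f.finrank_range_add_finrank_ker
  have hr : Module.finrank K (LinearMap.range f) ≤ 2 := by
    simpa using Submodule.finrank_le (LinearMap.range f)
  let i : LinearMap.ker f →ₗ[K] V := C.subtype ∘ₗ (LinearMap.ker f).subtype
  obtain ⟨x, hx, h₁, h₂⟩ := QuadraticMap.exists_common_zero
    (U := LinearMap.ker f) (by omega) (Q₁.comp i) (Q₂.comp i)
  replace h₁ : Q₁ (i x) = 0 := h₁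
  replace h₂ : Q₂ (i x) = 0 := h₂
  have hfx : (QuadraticMap.polar Q₁ p (i x), QuadraticMap.polar Q₂ p (i x)) = (0, 0) := x.2
  obtain ⟨e₁, e₂⟩ := Prod.mk.inj hfx
  refine ⟨i x, fun hmem => hx (Subtype.ext (Subtype.ext
    (Submodule.disjoint_def.1 hC.disjoint _ hmem x.1.2))), fun a b => ⟨?_, ?_⟩⟩
  · rw [QuadraticMap.map_add Q₁, QuadraticMap.map_smul, QuadraticMap.map_smul,
      QuadraticMap.polar_smul_left, QuadraticMap.polar_smul_right, hp₁, h₁, e₁]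
    simp
  · rw [QuadraticMap.map_add Q₂, QuadraticMap.map_smul, QuadraticMap.map_smul,
      QuadraticMap.polar_smul_left, QuadraticMap.polar_smul_right, hp₂, h₂, e₂]
    simp
end

section
/- Let X be an irreducible topological space. Let {V_j}_{j ∈ J} be an open cover of X. For each j ∈ J, let {(U_{j,k}, π_{j,k})}_{k ∈ K_j} be a family where each U_{j,k} ⊆ X is open, π_{j,k} : U_{j,k} → Z_{j,k} is a map to some set Z_{j,k}, the sets U_{j,k} (k ∈ K_j) cover V_j and are contained in V_j, and the family is transversal on V_j: every nonempty subset T ⊆ V_j satisfying T ∩ U_{j,k} = π_{j,k}⁻¹(π_{j,k}(T ∩ U_{j,k})) for all k ∈ K_j equals V_j. Then the combined family {(U_{j,k}, π_{j,k})}_{j ∈ J, k ∈ K_j} is a transversal covering of X: every nonempty subset S ⊆ X satisfying S ∩ U_{j,k} = π_{j,k}⁻¹(π_{j,k}(S ∩ U_{j,k})) for all j, k equals X. -/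
/-- Lemma 3.2(1) of the paper, set-theoretically: if an irreducible space `X` is
covered by open sets `V j`, each of which carries a transversal covering by
"cylinders" `(U j k, π j k)` contained in `V j`, then the combined family is a
transversal covering of `X`.  A subset `S` is invariant w.r.t. `(U, π)` when
`S ∩ U = π⁻¹(π(S ∩ U))` (inside `U`). -/
theorem stmt_11 (X : Type*) [TopologicalSpace X] [IrreducibleSpace X]
    (J : Type*) (V : J → Set X)
    (hVopen : ∀ j, IsOpen (V j)) (hVcov : ∀ x : X, ∃ j, x ∈ V j)
    (Kidx : J → Type*) (Z : (j : J) → Kidx j → Type*)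
    (U : (j : J) → Kidx j → Set X)
    (hUopen : ∀ j k, IsOpen (U j k))
    (π : (j : J) → (k : Kidx j) → (U j k) → Z j k)
    (hUV : ∀ j k, U j k ⊆ V j)
    (hUcov : ∀ j, ∀ x ∈ V j, ∃ k, x ∈ U j k)
    (htrans : ∀ j, ∀ T : Set X, T ⊆ V j → T.Nonempty →
      (∀ k, (Subtype.val ⁻¹' T : Set (U j k)) =
        π j k ⁻¹' (π j k '' (Subtype.val ⁻¹' T))) →
      T = V j)
    (S : Set X) (hSne : S.Nonempty)
    (hSinv : ∀ j k, (Subtype.val ⁻¹' S : Set (U j k)) =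
      π j k ⁻¹' (π j k '' (Subtype.val ⁻¹' S))) :
    S = Set.univ := by
  have hsub : ∀ j, (S ∩ V j).Nonempty → V j ⊆ S := by
    intro j hne
    have hT : S ∩ V j = V j := by
      refine htrans j (S ∩ V j) Set.inter_subset_right hne fun k => ?_
      have hpre : (Subtype.val ⁻¹' (S ∩ V j) : Set (U j k)) = Subtype.val ⁻¹' S := by
        ext x
        exact and_iff_left (hUV j k x.2)
      rw [hpre]
      exact hSinv j k
    exact Set.inter_eq_right.mp hT
  obtain ⟨x, hx⟩ := hSne
  obtain ⟨i, hxi⟩ := hVcov x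
  refine Set.eq_univ_of_forall fun y => ?_
  obtain ⟨j, hyj⟩ := hVcov y
  obtain ⟨z, hzi, hzj⟩ :=
    nonempty_preirreducible_inter (hVopen i) (hVopen j) ⟨x, hxi⟩ ⟨y, hyj⟩
  exact hsub j ⟨z, hsub i ⟨x, hx, hxi⟩ hzi, hzj⟩ hyj
end

section
/- Let Y be a set, Y₀ ⊆ Y a subset, and π : Y → Y₀ a retraction, i.e. π(y) = y for all y ∈ Y₀. Let {(U_i, f_i)}_{i ∈ I} be a family where each U_i ⊆ Y₀, f_i : U_i → Z_i is a map to some set Z_i, the U_i cover Y₀, and the family is transversal on Y₀: every nonempty subset T ⊆ Y₀ satisfying T ∩ U_i = f_i⁻¹(f_i(T ∩ U_i)) for all i ∈ I equals Y₀. Define Û_i = π⁻¹(U_i) and g_i = f_i ∘ π : Û_i → Z_i. Then the sets Û_i cover Y, and the family {(Û_i, g_i)}_{i ∈ I} is transversal on Y: every nonempty subset S ⊆ Y satisfying S ∩ Û_i = g_i⁻¹(g_i(S ∩ Û_i)) for all i ∈ I equals Y. -/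
/-- Lemma 5.4 of the paper, set-theoretically: given a retraction `π : Y → Y₀` and
a transversal covering `{(Uᵢ, fᵢ)}` of `Y₀` by "cylinders", the lifted family
`Ûᵢ = π⁻¹(Uᵢ)`, `gᵢ = fᵢ ∘ π` covers `Y` and is transversal on `Y`.  A subset `S`
is invariant w.r.t. `(U, f)` when `S ∩ U = f⁻¹(f(S ∩ U))` (inside `U`). -/
theorem stmt_13 (Y : Type*) (Y₀ : Set Y) (π : Y → Y₀)
    (hπ : ∀ y : Y₀, π (y : Y) = y)
    (I : Type*) (Z : I → Type*)
    (U : I → Set Y) (hUY₀ : ∀ i, U i ⊆ Y₀)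
    (f : (i : I) → (U i) → Z i)
    (hUcov : ∀ y ∈ Y₀, ∃ i, y ∈ U i)
    (htrans : ∀ T : Set Y, T ⊆ Y₀ → T.Nonempty →
      (∀ i, (Subtype.val ⁻¹' T : Set (U i)) =
        f i ⁻¹' (f i '' (Subtype.val ⁻¹' T))) →
      T = Y₀)
    -- the lifted cylinders and maps:
    (Uhat : I → Set Y) (hUhat : ∀ i, Uhat i = (fun y => (π y : Y)) ⁻¹' (U i))
    (g : (i : I) → (Uhat i) → Z i)
    (hg : ∀ i (y : Uhat i), g i y = f i ⟨(π (y : Y) : Y), by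
      have h := y.property; simp only [hUhat i, Set.mem_preimage] at h; exact h⟩) :
    (∀ y : Y, ∃ i, y ∈ Uhat i) ∧
      ∀ S : Set Y, S.Nonempty →
        (∀ i, (Subtype.val ⁻¹' S : Set (Uhat i)) =
          g i ⁻¹' (g i '' (Subtype.val ⁻¹' S))) →
        S = Set.univ := by
  have hmem : ∀ i (y : Y), (π y : Y) ∈ U i → y ∈ Uhat i := fun i y h => by
    rw [hUhat i]; exact h
  have hcov : ∀ y : Y, ∃ i, (π y : Y) ∈ U i := fun y => hUcov _ (π y).2
  refine ⟨fun y => (hcov y).imp fun i => hmem i y, fun S hS hinv => ?_⟩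
  -- an invariant set contains every point in the fiber of one of its points
  have key : ∀ i (a b : Y) (ha : (π a : Y) ∈ U i) (hb : (π b : Y) ∈ U i),
      f i ⟨π a, ha⟩ = f i ⟨π b, hb⟩ → a ∈ S → b ∈ S := by
    intro i a b ha hb hab haS
    have hb' : (⟨b, hmem i b hb⟩ : Uhat i) ∈ (Subtype.val ⁻¹' S : Set (Uhat i)) := by
      rw [hinv i]
      exact ⟨⟨a, hmem i a ha⟩, haS, by rw [hg, hg]; exact hab⟩
    exact hb'
  have hππ : ∀ y : Y, π (π y : Y) = π y := fun y => hπ (π y)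
  have hfiber : ∀ a b : Y, π a = π b → a ∈ S → b ∈ S := by
    intro a b hab
    obtain ⟨i, hi⟩ := hcov a
    exact key i a b hi (hab ▸ hi) (by simp only [hab])
  have hT : S ∩ Y₀ = Y₀ := by
    refine htrans _ Set.inter_subset_right ?_ fun i =>
      (Set.subset_preimage_image _ _).antisymm ?_
    · obtain ⟨s, hs⟩ := hS
      exact ⟨π s, hfiber s _ (hππ s).symm hs, (π s).2⟩
    · rintro x ⟨a, ha, hax⟩
      have hval : ∀ u : U i, (π (u : Y) : Y) = u := fun u =>
        congrArg Subtype.val (hπ ⟨u, hUY₀ i u.2⟩)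
      refine ⟨key i a x (by rw [hval]; exact a.2) (by rw [hval]; exact x.2) ?_ ha.1,
        hUY₀ i x.2⟩
      simpa only [hval] using hax
  refine Set.eq_univ_of_forall fun y => ?_
  exact hfiber (π y) y (hππ y) (Set.inter_eq_right.mp hT (π y).2)
end
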